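/- Let f: ℝ × ℝ → ℝ be a nonnegative function with compact support contained in [a₁,b₁] × [a₂,b₂], integrable in its first argument, and suppose that for every fixed x the function y ↦ f(x,y) belongs to the Hölder class H(β,L). Then the function g(y) = ∫ x f(x,y) dx belongs to the Hölder class H(β, L') for a constant L' depending only on L, a₁ and b₁ (in particular g is ⌊β⌋-times differentiable and |g^(⌊β⌋)(y) − g^(⌊β⌋)(y')| ≤ L'|y − y'|^{β−⌊β⌋} for all y, y'). -/

import Mathlib

open MeasureTheory

noncomputable section

/-- The Hölder class `H(β, L)` of functions on `ℝ`. -/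
def HolderClassH (β L : ℝ) (φ : ℝ → ℝ) : Prop :=
  ContDiff ℝ (⌊β⌋₊ : ℕ) φ ∧
    ∀ x x' : ℝ,
      |iteratedDeriv ⌊β⌋₊ φ x - iteratedDeriv ⌊β⌋₊ φ x'| ≤ L * |x - x'| ^ (β - (⌊β⌋₊ : ℝ))

/-- The iterated derivatives of a function supported in `[a, b]` vanish outside `[a, b]`. -/
lemma iteratedDeriv_eq_zero_of_notMem_Icc {φ : ℝ → ℝ} {a b : ℝ}
    (h : ∀ y, φ y ≠ 0 → y ∈ Set.Icc a b) (k : ℕ) {y : ℝ} (hy : y ∉ Set.Icc a b) :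
    iteratedDeriv k φ y = 0 := by
  have hev : φ =ᶠ[nhds y] fun _ => 0 := by
    filter_upwards [isClosed_Icc.isOpen_compl.mem_nhds hy] with z hz
    by_contra hne
    exact hz (h z hne)
  rw [hev.iteratedDeriv_eq k]
  simp

/-- A function supported in `[a, b]` with derivative bounded by `C` is bounded by
`C * (b + 1 - a)`. -/
lemma abs_le_of_abs_deriv_le_of_support {ψ : ℝ → ℝ} {a b C : ℝ} (hab : a ≤ b)
    (hd : Differentiable ℝ ψ) (hC : ∀ y, |deriv ψ y| ≤ C)
    (h0 : ∀ y, y ∉ Set.Icc a b → ψ y = 0) (y : ℝ) : |ψ y| ≤ C * (b + 1 - a) := by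
  have hC0 : 0 ≤ C := (abs_nonneg _).trans (hC 0)
  by_cases hy : y ∈ Set.Icc a b
  · have hmv := Convex.norm_image_sub_le_of_norm_deriv_le (f := ψ) (s := Set.univ) (C := C)
      (fun x _ => hd x) (fun x _ => hC x) convex_univ (Set.mem_univ (b + 1)) (Set.mem_univ y)
    have hb : ψ (b + 1) = 0 := h0 _ (fun hmem => by linarith [hmem.2])
    rw [hb, sub_zero, Real.norm_eq_abs, Real.norm_eq_abs] at hmv
    refine hmv.trans (mul_le_mul_of_nonneg_left ?_ hC0)
    rw [abs_le]
    constructor <;> linarith [hy.1, hy.2]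
  · rw [h0 y hy, abs_zero]
    exact mul_nonneg hC0 (by linarith)

/-- Functions in a common Hölder class supported in a common compact interval have uniformly
bounded derivatives up to order `⌊β⌋`. -/
lemma exists_forall_abs_iteratedDeriv_le {ι : Type*} {β L a b : ℝ} (hβ : 0 ≤ β) (hL : 0 ≤ L)
    (hab : a ≤ b) {φ : ι → ℝ → ℝ} (hsupp : ∀ i y, φ i y ≠ 0 → y ∈ Set.Icc a b)
    (hφ : ∀ i, HolderClassH β L (φ i)) {k : ℕ} (hk : k ≤ ⌊β⌋₊) :
    ∃ C, ∀ i y, |iteratedDeriv k (φ i) y| ≤ C := by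
  induction hk using Nat.decreasingInduction with
  | self =>
    have hs : 0 ≤ β - (⌊β⌋₊ : ℝ) := sub_nonneg.2 (Nat.floor_le hβ)
    refine ⟨L * (b + 1 - a) ^ (β - (⌊β⌋₊ : ℝ)), fun i y => ?_⟩
    by_cases hy : y ∈ Set.Icc a b
    · have hb : iteratedDeriv ⌊β⌋₊ (φ i) (b + 1) = 0 :=
        iteratedDeriv_eq_zero_of_notMem_Icc (hsupp i) _ (fun hmem => by linarith [hmem.2])
      have h := (hφ i).2 y (b + 1)
      rw [hb, sub_zero] at h
      refine h.trans (mul_le_mul_of_nonneg_left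
        (Real.rpow_le_rpow (abs_nonneg _) ?_ hs) hL)
      rw [abs_le]
      constructor <;> linarith [hy.1, hy.2]
    · rw [iteratedDeriv_eq_zero_of_notMem_Icc (hsupp i) _ hy, abs_zero]
      exact mul_nonneg hL (Real.rpow_nonneg (by linarith) _)
  | of_succ k hk ih =>
    obtain ⟨C, hC⟩ := ih
    refine ⟨C * (b + 1 - a), fun i => abs_le_of_abs_deriv_le_of_support hab
      ((hφ i).1.differentiable_iteratedDeriv k (by exact_mod_cast hk)) (fun y => ?_)
      (fun y hy => iteratedDeriv_eq_zero_of_notMem_Icc (hsupp i) k hy)⟩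
    rw [← iteratedDeriv_succ]
    exact hC i y

lemma iteratedDeriv_eq_of_hasDerivAt {G : ℕ → ℝ → ℝ} {n : ℕ}
    (h : ∀ k < n, ∀ y, HasDerivAt (G k) (G (k + 1) y) y) {k : ℕ} (hk : k ≤ n) :
    iteratedDeriv k (G 0) = G k := by
  induction k with
  | zero => exact iteratedDeriv_zero
  | succ k ih =>
    rw [iteratedDeriv_succ, ih (by omega)]
    exact funext fun y => (h k (by omega) y).deriv

/-- Remark 1: if `f(x, ·) ∈ H(β, L)` uniformly in `x` and `f` is supported in
`[a₁,b₁] × [a₂,b₂]`, then `g(y) = ∫ x f(x,y) dx` belongs to `H(β, L')` with `L'` depending only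
on `L`, `a₁`, `b₁`. -/
theorem statement_7 (L a₁ b₁ : ℝ) (hL : 0 < L) (hab₁ : a₁ < b₁) :
    ∃ L' : ℝ, 0 < L' ∧
      ∀ (β a₂ b₂ : ℝ), 0 < β → a₂ < b₂ →
      ∀ f : ℝ → ℝ → ℝ,
        (∀ x y, 0 ≤ f x y) →
        (∀ x y, f x y ≠ 0 → x ∈ Set.Icc a₁ b₁ ∧ y ∈ Set.Icc a₂ b₂) →
        (∀ y, Integrable (fun x => f x y)) →
        (∀ x, HolderClassH β L (fun y => f x y)) →
        (∀ n : ℕ, n ≤ ⌊β⌋₊ → ∀ y : ℝ,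
          Integrable (fun x => x * iteratedDeriv n (fun y' => f x y') y)) →
        HolderClassH β L' (fun y => ∫ x : ℝ, x * f x y) := by
  set M : ℝ := ∫ x, (Set.Icc a₁ b₁).indicator (fun x => |x|) x with hM
  have hI : Integrable ((Set.Icc a₁ b₁).indicator (fun x : ℝ => |x|)) :=
    (continuous_abs.continuousOn.integrableOn_compact isCompact_Icc).integrable_indicator
      measurableSet_Icc
  have hM0 : 0 ≤ M := integral_nonneg fun x => Set.indicator_nonneg (fun _ _ => abs_nonneg _) x
  refine ⟨L * M + 1, by positivity, ?_⟩
  intro β a₂ b₂ hβ hab₂ f _ hsupp _ hH hint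
  have hzero : ∀ x ∉ Set.Icc a₁ b₁, ∀ k y, iteratedDeriv k (f x) y = 0 := by
    intro x hx k y
    have hfx : f x = fun _ => 0 := funext fun z => by
      by_contra hne
      exact hx (hsupp x z hne).1
    rw [hfx]
    simp
  have hdom : ∀ (c : ℝ → ℝ) (C x : ℝ), (x ∉ Set.Icc a₁ b₁ → c x = 0) → |c x| ≤ C →
      ‖x * c x‖ ≤ C * (Set.Icc a₁ b₁).indicator (fun x => |x|) x := by
    intro c C x h0 hC
    by_cases hx : x ∈ Set.Icc a₁ b₁
    · rw [Set.indicator_of_mem hx, Real.norm_eq_abs, abs_mul, mul_comm]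
      exact mul_le_mul_of_nonneg_right hC (abs_nonneg _)
    · rw [h0 hx, Set.indicator_of_notMem hx]
      simp
  have hbound : ∀ k ≤ ⌊β⌋₊, ∃ C, ∀ x y, ‖x * iteratedDeriv k (f x) y‖ ≤
      C * (Set.Icc a₁ b₁).indicator (fun x => |x|) x := by
    intro k hk
    obtain ⟨C, hC⟩ := exists_forall_abs_iteratedDeriv_le hβ.le hL.le hab₂.le
      (fun x y h => (hsupp x y h).2) hH hk
    exact ⟨C, fun x y => hdom (fun x => iteratedDeriv k (f x) y) C x
      (fun hx => hzero x hx k y) (hC x y)⟩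
  let G : ℕ → ℝ → ℝ := fun k y => ∫ x, x * iteratedDeriv k (f x) y
  have hG0 : G 0 = fun y => ∫ x, x * f x y := by simp [G]
  have hderiv : ∀ k < ⌊β⌋₊, ∀ y, HasDerivAt (G k) (G (k + 1) y) y := by
    intro k hk y
    obtain ⟨C, hC⟩ := hbound (k + 1) hk
    refine (hasDerivAt_integral_of_dominated_loc_of_deriv_le
      (F := fun y x => x * iteratedDeriv k (f x) y)
      (F' := fun y x => x * iteratedDeriv (k + 1) (f x) y) Filter.univ_mem
      (Filter.Eventually.of_forall fun z => (hint k hk.le z).aestronglyMeasurable)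
      (hint k hk.le y) (hint (k + 1) hk y).aestronglyMeasurable
      (Filter.Eventually.of_forall fun x z _ => hC x z) (hI.const_mul C)
      (Filter.Eventually.of_forall fun x z _ => ?_)).2
    rw [iteratedDeriv_succ]
    exact ((hH x).1.differentiable_iteratedDeriv k (by exact_mod_cast hk) z).hasDerivAt.const_mul x
  have hcont : ∀ k ≤ ⌊β⌋₊, Continuous (G k) := by
    intro k hk
    obtain ⟨C, hC⟩ := hbound k hk
    exact continuous_of_dominated (fun y => (hint k hk y).aestronglyMeasurable)
      (fun y => Filter.Eventually.of_forall fun x => hC x y) (hI.const_mul C)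
      (Filter.Eventually.of_forall fun x => continuous_const.mul
        ((hH x).1.continuous_iteratedDeriv k (by exact_mod_cast hk)))
  rw [← hG0]
  refine ⟨contDiff_iff_iteratedDeriv.2 ⟨fun m hm => ?_, fun m hm => ?_⟩, fun y y' => ?_⟩
  · have hm' : m ≤ ⌊β⌋₊ := by exact_mod_cast hm
    rw [iteratedDeriv_eq_of_hasDerivAt hderiv hm']
    exact hcont m hm'
  · have hm' : m < ⌊β⌋₊ := by exact_mod_cast hm
    rw [iteratedDeriv_eq_of_hasDerivAt hderiv hm'.le]
    exact fun y => (hderiv m hm' y).differentiableAt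
  · rw [iteratedDeriv_eq_of_hasDerivAt hderiv le_rfl]
    have hpow : 0 ≤ |y - y'| ^ (β - (⌊β⌋₊ : ℝ)) := Real.rpow_nonneg (abs_nonneg _) _
    have hsub : G ⌊β⌋₊ y - G ⌊β⌋₊ y' =
        ∫ x, x * (iteratedDeriv ⌊β⌋₊ (f x) y - iteratedDeriv ⌊β⌋₊ (f x) y') := by
      simp_rw [mul_sub]
      exact (integral_sub (hint _ le_rfl y) (hint _ le_rfl y')).symm
    have hle : |G ⌊β⌋₊ y - G ⌊β⌋₊ y'| ≤ L * |y - y'| ^ (β - (⌊β⌋₊ : ℝ)) * M := by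
      rw [hsub, hM, ← integral_const_mul, ← Real.norm_eq_abs]
      refine norm_integral_le_of_norm_le (hI.const_mul _) (Filter.Eventually.of_forall fun x => ?_)
      exact hdom (fun x => iteratedDeriv ⌊β⌋₊ (f x) y - iteratedDeriv ⌊β⌋₊ (f x) y') _ x
        (fun hx => by simp [hzero x hx]) ((hH x).2 y y')
    linarith
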